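/- arXiv:1001.2387 — 2 statements merged into one kernel-verified Lean document; each statement's English description precedes it below -/
import Mathlib

section
/- Let n ≥ 2 and let f be a homogeneous cubic polynomial on ℝⁿ satisfying the eiconal equation |∇f(x)|² = 9|x|⁴ for all x ∈ ℝⁿ. If f is irreducible as a polynomial over ℝ, then n ∈ {5, 8, 14, 26}. -/
open MvPolynomial

section Eiconal

open scoped RealInnerProductSpace
open Module (finrank)
open Module.End (eigenspace mem_eigenspace_iff)

variable {E : Type*} [NormedAddCommGroup E] [InnerProductSpace ℝ E]

/-- A commutative bilinear product `m` whose multiplications are symmetric and which satisfies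
`|x ∘ x|² = |x|⁴`. Such products correspond to cubic forms `⟪x ∘ x, x⟫` solving the eiconal
equation. -/
structure IsEiconalProduct (m : E →ₗ[ℝ] E →ₗ[ℝ] E) : Prop where
  comm : ∀ x y, m x y = m y x
  symm : ∀ x y z, ⟪m x y, z⟫ = ⟪y, m x z⟫
  inner_sq_sq : ∀ x, ⟪m x x, m x x⟫ = ⟪x, x⟫ ^ 2

namespace IsEiconalProduct

variable {m : E →ₗ[ℝ] E →ₗ[ℝ] E} (hm : IsEiconalProduct m)
include hm

theorem inner_sq_mul (x y : E) : ⟪m x x, m x y⟫ = ⟪x, x⟫ * ⟪x, y⟫ := by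
  have h : ∀ t : ℝ, ⟪m x x + (2 * t) • m x y + t ^ 2 • m y y,
      m x x + (2 * t) • m x y + t ^ 2 • m y y⟫ =
        (⟪x, x⟫ + 2 * t * ⟪x, y⟫ + t ^ 2 * ⟪y, y⟫) ^ 2 := by
    intro t
    have h := hm.inner_sq_sq (x + t • y)
    have e1 : m (x + t • y) (x + t • y) = m x x + (2 * t) • m x y + t ^ 2 • m y y := by
      simp only [map_add, map_smul, LinearMap.add_apply, LinearMap.smul_apply, hm.comm y x]
      module
    have e2 : ⟪x + t • y, x + t • y⟫ = ⟪x, x⟫ + 2 * t * ⟪x, y⟫ + t ^ 2 * ⟪y, y⟫ := by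
      simp only [inner_add_left, inner_add_right, inner_smul_left, inner_smul_right,
        real_inner_comm x y, conj_trivial]
      ring
    rwa [e1, e2] at h
  simp only [inner_add_left, inner_add_right, inner_smul_left, inner_smul_right, conj_trivial] at h
  have c1 := real_inner_comm (m x x) (m x y)
  have c2 := real_inner_comm (m x x) (m y y)
  have c3 := real_inner_comm (m x y) (m y y)
  have h1 := h 1
  have h2 := h (-1)
  have h3 := h 2
  have h4 := h (-2)
  linear_combination (1 / 6 : ℝ) * (h1 - h2) - (1 / 48 : ℝ) * (h3 - h4) - (1 / 2 : ℝ) * c1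

theorem mul_sq (x : E) : m x (m x x) = ⟪x, x⟫ • x := by
  refine ext_inner_right ℝ fun y => ?_
  rw [hm.symm, hm.inner_sq_mul, inner_smul_left, conj_trivial]

theorem mul_mul_add (x y z : E) :
    m x (m y z) + m y (m x z) + m z (m x y) = ⟪x, y⟫ • z + ⟪y, z⟫ • x + ⟪x, z⟫ • y := by
  have e (s t : ℝ) := hm.mul_sq (x + s • y + t • z)
  simp only [map_add, map_smul, LinearMap.add_apply, LinearMap.smul_apply, inner_add_left,
    inner_add_right, inner_smul_left, inner_smul_right, conj_trivial] at e
  have h1 := e 1 1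
  have h2 := e 1 (-1)
  have h3 := e (-1) 1
  have h4 := e (-1) (-1)
  rw [hm.comm z x, hm.comm z y, hm.comm y x, real_inner_comm x y, real_inner_comm x z,
    real_inner_comm y z] at h1 h2 h3 h4
  linear_combination (norm := module) (1 / 8 : ℝ) • (h1 - h2 - h3 + h4)

theorem exists_idempotent [FiniteDimensional ℝ E] [Nontrivial E] :
    ∃ e : E, ⟪e, e⟫ = 1 ∧ m e e = e := by
  have hcont : Continuous fun x : E => ⟪m x x, x⟫ := by
    have h : Continuous fun x : E => m.toContinuousBilinearMap x x := by fun_prop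
    exact h.inner continuous_id
  obtain ⟨e, he, hmax⟩ := (isCompact_sphere (0 : E) 1).exists_isMaxOn
    (NormedSpace.sphere_nonempty.2 zero_le_one) hcont.continuousOn
  have hnorm : ‖e‖ = 1 := by simpa using he
  have hee : ⟪e, e⟫ = 1 := by rw [real_inner_self_eq_norm_sq, hnorm, one_pow]
  replace hmax : ∀ x : E, ‖x‖ = 1 → ⟪m x x, x⟫ ≤ ⟪m e e, e⟫ :=
    fun x hx => hmax (by simpa using hx)
  set c := ⟪m e e, e⟫ with hc
  have hc0 : 0 ≤ c := by
    have := hmax (-e) (by simpa using hnorm)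
    simp only [map_neg, LinearMap.neg_apply, neg_neg, inner_neg_right] at this
    linarith
  refine ⟨e, hee, ?_⟩
  set w := m e e with hw
  have hew : m e w = e := by rw [hw, hm.mul_sq, hee, one_smul]
  have hww : ⟪w, w⟫ = 1 := by rw [hw, hm.inner_sq_sq, hee, one_pow]
  have hmww : m w w = (2 * c) • e - w := by
    have h := hm.mul_mul_add e e w
    rw [hew, ← hw, hee, real_inner_comm w e, ← hc] at h
    linear_combination (norm := module) h
  have hadd : ⟪m (e + w) (e + w), e + w⟫ = 2 * (1 + c) ^ 2 := by
    have e1 : m (e + w) (e + w) = (2 + 2 * c) • e := by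
      simp only [map_add, LinearMap.add_apply, hm.comm w e, hew, hmww, ← hw]
      module
    rw [e1, inner_smul_left, inner_add_right, hee, real_inner_comm, ← hc, conj_trivial]
    ring
  have hnadd : ⟪e + w, e + w⟫ = 2 + 2 * c := by
    rw [inner_add_left, inner_add_right, inner_add_right, hee, hww, real_inner_comm w e, ← hc]
    ring
  set s := ‖e + w‖ with hs
  have hs2 : s ^ 2 = 2 + 2 * c := by rw [hs, ← real_inner_self_eq_norm_sq, hnadd]
  have hs0 : 0 < s := by
    rcases (norm_nonneg (e + w)).lt_or_eq with h | h
    · exact h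
    · rw [← hs] at h
      rw [← h] at hs2
      linarith
  have hle := hmax (s⁻¹ • (e + w)) (by
    rw [norm_smul, norm_inv, norm_norm, inv_mul_cancel₀ hs0.ne'])
  rw [map_smul, map_smul, LinearMap.smul_apply, inner_smul_left, inner_smul_left, inner_smul_right,
    hadd, conj_trivial] at hle
  have hs4 : 2 * (1 + c) ^ 2 = s ^ 3 * (s / 2) := by
    linear_combination (- (s ^ 2 + (2 + 2 * c)) / 2) * hs2
  have hs1 : s ≤ 2 * c := by
    rw [hs4] at hle
    field_simp at hle
    linarith
  have hc1 : 1 ≤ c := by nlinarith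
  have : ⟪w - e, w - e⟫ ≤ 0 := by
    rw [inner_sub_left, inner_sub_right, inner_sub_right, hee, hww, real_inner_comm w e, ← hc]
    linarith
  exact sub_eq_zero.1 (real_inner_self_nonpos.1 this)

section Peirce

variable {e : E}

theorem inner_eq_zero_of_mem_eigenspace (hee : m e e = e) {μ : ℝ} (hμ : μ ≠ 1) {x : E}
    (hx : m e x = μ • x) : ⟪e, x⟫ = 0 := by
  have h := hm.symm e e x
  rw [hee, hx, inner_smul_right] at h
  have : (μ - 1) * ⟪e, x⟫ = 0 := by linear_combination -h
  exact (mul_eq_zero.1 this).resolve_left (sub_ne_zero.2 hμ)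

theorem inner_mem_eigenspace {u v : E} (hu : m e u = (-1 : ℝ) • u)
    (hv : m e v = (1 / 2 : ℝ) • v) : ⟪u, v⟫ = 0 := by
  have h := hm.symm e u v
  rw [hu, hv, inner_smul_left, inner_smul_right, conj_trivial] at h
  linarith

theorem mul_half_half (hee : m e e = e) {v v' : E} (hv : m e v = (1 / 2 : ℝ) • v)
    (hv' : m e v' = (1 / 2 : ℝ) • v') :
    m e (m v v' - (⟪v, v'⟫ / 2) • e) = (-1 : ℝ) • (m v v' - (⟪v, v'⟫ / 2) • e) := by
  have h0 := hm.inner_eq_zero_of_mem_eigenspace hee (by norm_num) hv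
  have h0' := hm.inner_eq_zero_of_mem_eigenspace hee (by norm_num) hv'
  have h := hm.mul_mul_add e v v'
  rw [hv, hv', map_smul, map_smul, hm.comm v' v, h0, h0'] at h
  rw [map_sub, map_smul, hee]
  linear_combination (norm := module) h

theorem mul_neg_half (hee : m e e = e) {u v : E} (hu : m e u = (-1 : ℝ) • u)
    (hv : m e v = (1 / 2 : ℝ) • v) :
    m e (m u v) = (1 / 2 : ℝ) • m u v := by
  have h := hm.mul_mul_add e u v
  rw [hu, hv, map_smul, map_smul, hm.comm v u,
    hm.inner_eq_zero_of_mem_eigenspace hee (by norm_num) hu,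
    hm.inner_eq_zero_of_mem_eigenspace hee (by norm_num) hv,
    hm.inner_mem_eigenspace hu hv] at h
  linear_combination (norm := module) h

variable (he : ⟪e, e⟫ = 1) (hee : m e e = e)
include he hee

theorem mul_idempotent (x : E) : (2 : ℝ) • m e (m e x) + m e x = x + (2 * ⟪e, x⟫) • e := by
  have h := hm.mul_mul_add e e x
  rw [hm.comm x, hee, he] at h
  linear_combination (norm := module) h

theorem mul_neg_neg {u u' : E} (hu : m e u = (-1 : ℝ) • u) (hu' : m e u' = (-1 : ℝ) • u') :
    m u u' = (-⟪u, u'⟫) • e := by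
  have h0 := hm.inner_eq_zero_of_mem_eigenspace hee (by norm_num) hu
  have h0' := hm.inner_eq_zero_of_mem_eigenspace hee (by norm_num) hu'
  have h := hm.mul_mul_add e u u'
  rw [hu, hu', map_smul, map_smul, hm.comm u' u, h0, h0'] at h
  have hin : ⟪e, m u u'⟫ = -⟪u, u'⟫ := by
    rw [← hm.symm, hm.comm, hu, inner_smul_left]
    simp
  have h1 : m e (m u u') = (2 : ℝ) • m u u' + ⟪u, u'⟫ • e := by
    linear_combination (norm := module) h
  have h2 := hm.mul_idempotent he hee (m u u')
  rw [hin, h1, map_add, map_smul, map_smul, h1, hee] at h2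
  linear_combination (norm := module) (1 / 9 : ℝ) • h2

theorem mul_mul_neg_half {u u' v : E} (hu : m e u = (-1 : ℝ) • u)
    (hu' : m e u' = (-1 : ℝ) • u') (hv : m e v = (1 / 2 : ℝ) • v) :
    m u (m u' v) + m u' (m u v) = (3 / 2 * ⟪u, u'⟫) • v := by
  have h := hm.mul_mul_add u u' v
  rw [hm.mul_neg_neg he hee hu hu', map_smul, hm.comm v e, hv,
    hm.inner_mem_eigenspace hu hv, hm.inner_mem_eigenspace hu' hv] at h
  linear_combination (norm := module) h

/-- The Peirce decomposition `E = ℝ e ⊕ E₋₁ ⊕ E_{1/2}` of an idempotent `e`. -/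
theorem exists_peirce (x : E) :
    ∃ t : ℝ, ∃ u ∈ eigenspace (m e) (-1), ∃ v ∈ eigenspace (m e) (1 / 2), x = t • e + u + v := by
  have h := hm.mul_idempotent he hee x
  refine ⟨⟪e, x⟫, (1 / 3 : ℝ) • (x + ⟪e, x⟫ • e - (2 : ℝ) • m e x),
    mem_eigenspace_iff.2 ?_, (2 / 3 : ℝ) • (x + m e x - (2 * ⟪e, x⟫) • e),
    mem_eigenspace_iff.2 ?_, ?_⟩
  · simp only [map_smul, map_add, map_sub, hee]
    linear_combination (norm := module) (-1 / 3 : ℝ) • h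
  · simp only [map_smul, map_add, map_sub, hee]
    linear_combination (norm := module) (1 / 3 : ℝ) • h
  · module

theorem finrank_eq [FiniteDimensional ℝ E] : finrank ℝ E =
    1 + finrank ℝ (eigenspace (m e) (-1)) + finrank ℝ (eigenspace (m e) (1 / 2)) := by
  let φ : (ℝ × eigenspace (m e) (-1)) × eigenspace (m e) (1 / 2) →ₗ[ℝ] E :=
    ((LinearMap.toSpanSingleton ℝ E e).coprod (Submodule.subtype _)).coprod (Submodule.subtype _)
  have hφ : ∀ t u v, φ ((t, u), v) = t • e + u + v := fun t u v => by simp [φ]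
  have hbij : Function.Bijective φ := by
    refine ⟨(injective_iff_map_eq_zero φ).2 ?_, fun x => ?_⟩
    · rintro ⟨⟨t, u⟩, v⟩ h
      rw [hφ] at h
      have hu := mem_eigenspace_iff.1 u.2
      have hv := mem_eigenspace_iff.1 v.2
      have ht : t = 0 := by
        have := congrArg (fun z => ⟪e, z⟫) h
        simpa only [inner_add_right, inner_smul_right, he, inner_zero_right, mul_one, add_zero,
          hm.inner_eq_zero_of_mem_eigenspace hee (by norm_num) hu,
          hm.inner_eq_zero_of_mem_eigenspace hee (by norm_num) hv] using this
      rw [ht, zero_smul, zero_add] at h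
      have h' := congrArg (m e) h
      rw [map_add, map_zero, hu, hv] at h'
      have hu0 : (u : E) = 0 := by
        linear_combination (norm := module) (1 / 3 : ℝ) • h - (2 / 3 : ℝ) • h'
      have hv0 : (v : E) = 0 := by
        linear_combination (norm := module) (2 / 3 : ℝ) • h + (2 / 3 : ℝ) • h'
      simp only [Prod.mk_eq_zero]
      exact ⟨⟨ht, Subtype.ext hu0⟩, Subtype.ext hv0⟩
    · obtain ⟨t, u, hu, v, hv, rfl⟩ := hm.exists_peirce he hee x
      exact ⟨((t, ⟨u, hu⟩), ⟨v, hv⟩), hφ _ _ _⟩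
  rw [← (LinearEquiv.ofBijective φ hbij).finrank_eq, Module.finrank_prod, Module.finrank_prod,
    Module.finrank_self]

theorem inner_peirce {t : ℝ} {u v : E} (hu : m e u = (-1 : ℝ) • u)
    (hv : m e v = (1 / 2 : ℝ) • v) :
    ⟪t • e + u + v, t • e + u + v⟫ = t ^ 2 + ⟪u, u⟫ + ⟪v, v⟫ := by
  have h1 := hm.inner_eq_zero_of_mem_eigenspace hee (by norm_num) hu
  have h2 := hm.inner_eq_zero_of_mem_eigenspace hee (by norm_num) hv
  have h3 := hm.inner_mem_eigenspace hu hv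
  simp only [inner_add_left, inner_add_right, inner_smul_left, inner_smul_right, conj_trivial,
    real_inner_comm e u, real_inner_comm e v, real_inner_comm u v, h1, h2, h3, he]
  ring

theorem cubic_peirce {t : ℝ} {u v : E} (hu : m e u = (-1 : ℝ) • u)
    (hv : m e v = (1 / 2 : ℝ) • v) :
    ⟪m (t • e + u + v) (t • e + u + v), t • e + u + v⟫ =
      t ^ 3 - 3 * t * ⟪u, u⟫ + 3 / 2 * t * ⟪v, v⟫ + 3 * ⟪m u v, v⟫ := by
  have h1 := hm.inner_eq_zero_of_mem_eigenspace hee (by norm_num) hu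
  have h2 := hm.inner_eq_zero_of_mem_eigenspace hee (by norm_num) hv
  have h3 := hm.inner_mem_eigenspace hu hv
  have h4 := hm.inner_eq_zero_of_mem_eigenspace hee (by norm_num) (hm.mul_neg_half hee hu hv)
  have h5 := hm.inner_mem_eigenspace hu (hm.mul_neg_half hee hu hv)
  have h6 : ⟪m v v, e⟫ = ⟪v, v⟫ / 2 := by
    rw [hm.symm, hm.comm, hv, inner_smul_right]; ring
  have h7 : ⟪m v v, u⟫ = ⟪m u v, v⟫ := by
    rw [hm.symm, hm.comm, real_inner_comm]
  have h8 : ⟪m v v, v⟫ = 0 := by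
    have := hm.inner_mem_eigenspace (hm.mul_half_half hee hv hv) hv
    rw [inner_sub_left, inner_smul_left, h2] at this
    simpa using this
  have e1 : m (t • e + u + v) (t • e + u + v) = (t ^ 2 - ⟪u, u⟫) • e - (2 * t) • u + t • v +
      (2 : ℝ) • m u v + m v v := by
    simp only [map_add, map_smul, LinearMap.add_apply, LinearMap.smul_apply, hm.comm u e,
      hm.comm v e, hm.comm v u, hu, hv, hee, hm.mul_neg_neg he hee hu hu]
    module
  rw [e1]
  simp only [inner_add_left, inner_sub_left, inner_add_right, inner_smul_left, inner_smul_right,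
    conj_trivial, real_inner_comm e u, real_inner_comm e v, real_inner_comm u v,
    real_inner_comm e (m u v), real_inner_comm u (m u v), h1, h2, h3, h4, h5, h6, h7, h8, he]
  ring

end Peirce

end IsEiconalProduct
end Eiconal

section Anticommuting

open Module (End finrank)

theorem finrank_eq_two_mul_eigenspace {V : Type*} [AddCommGroup V] [Module ℂ V]
    [FiniteDimensional ℂ V] {S T : End ℂ V} {s c : ℂ} (hs : s ≠ 0) (hc : c ≠ 0)
    (hS : S * S = (s * s) • 1) (hT : T * T = c • 1) (hST : S * T = -(T * S)) :
    finrank ℂ V = 2 * finrank ℂ (S.eigenspace s) := by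
  have hS' (x : V) : S (S x) = (s * s) • x := by simpa using LinearMap.congr_fun hS x
  have hT' (x : V) : T (T x) = c • x := by simpa using LinearMap.congr_fun hT x
  have hST' (x : V) : S (T x) = -T (S x) := by simpa using LinearMap.congr_fun hST x
  let φ : S.eigenspace s × S.eigenspace s →ₗ[ℂ] V :=
    (Submodule.subtype _).coprod (T ∘ₗ Submodule.subtype _)
  have hφ : ∀ a b, φ (a, b) = a + T b := fun a b => by simp [φ]
  have hbij : Function.Bijective φ := by
    refine ⟨(injective_iff_map_eq_zero φ).2 ?_, fun x => ?_⟩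
    · rintro ⟨a, b⟩ h
      rw [hφ] at h
      have ha := Module.End.mem_eigenspace_iff.1 a.2
      have hb := Module.End.mem_eigenspace_iff.1 b.2
      have h' := congrArg S h
      rw [map_add, map_zero, hST', ha, hb, map_smul] at h'
      have ha0 : (a : V) = 0 := by
        have : (2 * s) • (a : V) = 0 := by linear_combination (norm := module) s • h + h'
        exact (smul_eq_zero.1 this).resolve_left (mul_ne_zero two_ne_zero hs)
      have hb0 : (b : V) = 0 := by
        rw [ha0, zero_add] at h
        have := hT' b
        rw [h, map_zero] at this
        exact (smul_eq_zero.1 this.symm).resolve_left hc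
      simp only [Prod.mk_eq_zero]
      exact ⟨Subtype.ext ha0, Subtype.ext hb0⟩
    · refine ⟨(⟨(1 / 2 : ℂ) • (x + s⁻¹ • S x), Module.End.mem_eigenspace_iff.2 ?_⟩,
        ⟨(1 / (2 * c) : ℂ) • T (x - s⁻¹ • S x), Module.End.mem_eigenspace_iff.2 ?_⟩), ?_⟩
      · rw [map_smul, map_add, map_smul, hS', smul_smul, smul_comm s]
        congr 1
        rw [smul_add, smul_smul, mul_inv_cancel₀ hs, one_smul, ← mul_assoc, inv_mul_cancel₀ hs,
          one_mul, add_comm]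
      · rw [map_smul, hST', map_sub, map_smul, hS', smul_smul, smul_comm s, ← mul_assoc,
          inv_mul_cancel₀ hs, one_mul]
        congr 1
        rw [← map_neg, ← map_smul, smul_sub, smul_smul, mul_inv_cancel₀ hs, one_smul, neg_sub]
      · rw [hφ]
        simp only [map_smul, hT']
        match_scalars <;> field_simp <;> ring
  rw [← (LinearEquiv.ofBijective φ hbij).finrank_eq, Module.finrank_prod, two_mul]

/-- `n` pairwise anticommuting operators with nonzero scalar squares can only act on a complex
vector space whose dimension is divisible by `2 ^ (n / 2)`. -/
theorem two_pow_dvd_finrank_of_anticommute (n : ℕ) {V : Type*} [AddCommGroup V] [Module ℂ V]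
    [FiniteDimensional ℂ V] (T : Fin n → End ℂ V) (hsq : ∀ i, ∃ c : ℂ, c ≠ 0 ∧ T i * T i = c • 1)
    (hanti : ∀ i j, i ≠ j → T i * T j = -(T j * T i)) : 2 ^ (n / 2) ∣ finrank ℂ V := by
  induction n using Nat.twoStepInduction generalizing V with
  | zero => simp
  | one => simp
  | more n ih _ =>
    obtain ⟨c₀, hc₀, h0⟩ := hsq 0
    obtain ⟨c₁, hc₁, h1⟩ := hsq 1
    obtain ⟨s, rfl⟩ := IsAlgClosed.exists_eq_mul_self c₀
    have hs : s ≠ 0 := fun h => hc₀ (by simp [h])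
    rw [finrank_eq_two_mul_eigenspace hs hc₁ h0 h1 (hanti 0 1 (by simp)),
      Nat.add_div_right n two_pos, pow_succ']
    refine mul_dvd_mul_left 2 ?_
    have hne (i : Fin n) : i.succ.succ ≠ 0 ∧ i.succ.succ ≠ 1 :=
      ⟨Fin.succ_ne_zero _, fun h => Fin.succ_ne_zero i (Fin.succ_injective _ h)⟩
    have hcomm (i : Fin n) : T 0 * (T 1 * T i.succ.succ) = T 1 * T i.succ.succ * T 0 := by
      rw [← mul_assoc, hanti 0 1 (by simp), neg_mul, mul_assoc, hanti 0 _ (hne i).1.symm, mul_neg,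
        neg_neg, mul_assoc]
    have hprod (i j : Fin n) : T 1 * T i.succ.succ * (T 1 * T j.succ.succ) =
        (-c₁) • (T i.succ.succ * T j.succ.succ) := by
      rw [hanti 1 _ (hne i).2.symm, neg_mul, mul_assoc, ← mul_assoc (T 1), h1, smul_one_mul,
        mul_smul_comm, neg_smul]
    have hmaps (i : Fin n) : ∀ x ∈ (T 0).eigenspace s,
        (T 1 * T i.succ.succ) x ∈ (T 0).eigenspace s := by
      intro x hx
      rw [Module.End.mem_eigenspace_iff] at hx ⊢
      have := LinearMap.congr_fun (hcomm i) x
      simp only [Module.End.mul_apply] at this ⊢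
      rw [this, hx, map_smul, map_smul]
    refine ih (fun i => (T 1 * T i.succ.succ).restrict (hmaps i)) (fun i => ?_) fun i j hij => ?_
    · obtain ⟨c, hc, h⟩ := hsq i.succ.succ
      refine ⟨-c₁ * c, mul_ne_zero (neg_ne_zero.2 hc₁) hc, LinearMap.ext fun x => Subtype.ext ?_⟩
      have := LinearMap.congr_fun (hprod i i) (x : V)
      rw [h, smul_smul] at this
      exact this
    · refine LinearMap.ext fun x => Subtype.ext ?_
      have e1 := LinearMap.congr_fun (hprod i j) (x : V)
      have e2 := LinearMap.congr_fun (hprod j i) (x : V)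
      rw [hanti _ _ fun h => hij (Fin.succ_injective _ (Fin.succ_injective _ h)), smul_neg,
        LinearMap.neg_apply, ← e2] at e1
      exact e1

theorem mem_of_two_pow_half_dvd {p : ℕ} (hp : 2 ≤ p) (h : 2 ^ (p / 2) ∣ 2 * (p - 1)) :
    p = 2 ∨ p = 3 ∨ p = 5 ∨ p = 9 := by
  obtain ⟨k, rfl | rfl⟩ := Nat.even_or_odd' p
  · have hk : 2 * k / 2 = k := by omega
    rw [hk] at h
    by_contra hne
    have h4 : 2 ^ 2 ∣ 2 * (2 * k - 1) := (pow_dvd_pow 2 (by omega)).trans h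
    omega
  · have hk : (2 * k + 1) / 2 = k := by omega
    rw [hk] at h
    have hle := Nat.le_of_dvd (by omega) h
    have hk5 : k < 5 := by
      by_contra! hk5
      have : ∀ m, 5 ≤ m → 4 * m < 2 ^ m := by
        intro m hm
        induction m, hm using Nat.le_induction with
        | base => norm_num
        | succ m hm ih => rw [pow_succ]; omega
      have := this k hk5
      omega
    interval_cases k <;> simp_all

end Anticommuting

section Clifford

open scoped RealInnerProductSpace
open Module (End finrank)

variable {U W : Type*} [NormedAddCommGroup U] [InnerProductSpace ℝ U]
  [NormedAddCommGroup W] [InnerProductSpace ℝ W]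

/-- A linear family `A` of anticommuting symmetric operators on `W`, together with the transposed
product `B : W × W → U`, as given by the Peirce components of an eiconal product. -/
structure IsPeirceClifford (A : U →ₗ[ℝ] End ℝ W) (B : W → W → U) : Prop where
  symm : ∀ u x y, ⟪A u x, y⟫ = ⟪x, A u y⟫
  anticomm : ∀ u u', A u * A u' + A u' * A u = (3 / 2 * ⟪u, u'⟫) • 1
  inner_left : ∀ v y u, ⟪B v y, u⟫ = ⟪A u v, y⟫
  cubic : ∀ v y, (2 : ℝ) • A (B v y) v + A (B v v) y = (3 / 4 * ⟪v, v⟫) • y + (3 / 2 * ⟪v, y⟫) • v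

namespace IsPeirceClifford

variable {A : U →ₗ[ℝ] End ℝ W} {B : W → W → U} (h : IsPeirceClifford A B)
include h

theorem mul_self (u : U) : A u * A u = (3 / 4 * ⟪u, u⟫) • 1 := by
  linear_combination (norm := module) (1 / 2 : ℝ) • h.anticomm u u

theorem inner_apply_self (u : U) (v : W) : ⟪A u v, A u v⟫ = 3 / 4 * ⟪u, u⟫ * ⟪v, v⟫ := by
  have := LinearMap.congr_fun (h.mul_self u) v
  rw [Module.End.mul_apply] at this
  rw [← h.symm, this, LinearMap.smul_apply, Module.End.one_apply, inner_smul_left, conj_trivial]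

theorem finrank_pos [Nontrivial W] [FiniteDimensional ℝ U] : 0 < finrank ℝ U := by
  obtain ⟨v, hv⟩ := exists_ne (0 : W)
  by_contra! hU
  have := Module.finrank_zero_iff.1 (Nat.le_zero.1 hU)
  have hc := h.cubic v v
  rw [Subsingleton.elim (B v v) 0, map_zero, LinearMap.zero_apply] at hc
  have h0 : ⟪v, v⟫ • v = 0 := by linear_combination (norm := module) (-4 / 9 : ℝ) • hc
  simp [hv] at h0

theorem exists_scalar [Nontrivial W] [FiniteDimensional ℝ U] (hU : finrank ℝ U = 1) :
    ∃ (u : U) (c : ℝ), ⟪u, u⟫ = 1 ∧ c ^ 2 = 3 / 4 ∧ (∀ v, A u v = c • v) ∧ ∀ x, x = ⟪u, x⟫ • u := by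
  let b := (stdOrthonormalBasis ℝ U).reindex (finCongr hU)
  have hb (x : U) : x = ⟪b 0, x⟫ • b 0 := by
    conv_lhs => rw [← b.sum_repr' x, Fin.sum_univ_one]
  have hB (v y : W) : B v y = ⟪A (b 0) v, y⟫ • b 0 := by
    conv_lhs => rw [hb (B v y), real_inner_comm, h.inner_left]
  have hu : ⟪b 0, b 0⟫ = 1 := by rw [real_inner_self_eq_norm_sq, b.norm_eq_one, one_pow]
  obtain ⟨v, hv⟩ := exists_ne (0 : W)
  obtain ⟨v, hv⟩ : ∃ v : W, ⟪v, v⟫ = 1 := ⟨‖v‖⁻¹ • v, by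
    rw [real_inner_self_eq_norm_sq, norm_smul, norm_inv, norm_norm,
      inv_mul_cancel₀ (norm_ne_zero_iff.2 hv), one_pow]⟩
  set u := b 0
  have hc (y : W) := h.cubic v y
  simp only [hB, map_smul, LinearMap.smul_apply, hv] at hc
  set c := ⟪A u v, v⟫ with hc'
  have hcv : c • A u v = (3 / 4 : ℝ) • v := by
    have := hc v
    rw [hv] at this
    linear_combination (norm := module) (1 / 3 : ℝ) • this
  have hc2 : c ^ 2 = 3 / 4 := by
    have := congrArg (fun z => ⟪z, v⟫) hcv
    simp only [inner_smul_left, conj_trivial, hv, ← hc'] at this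
    linarith
  have hc0 : c ≠ 0 := fun h0 => by norm_num [h0] at hc2
  have hcv' : A u v = c • v := by
    apply smul_right_injective W hc0
    simp only [smul_smul]
    rw [hcv, ← hc2, pow_two]
  refine ⟨u, c, hu, hc2, fun y => ?_, hb⟩
  have := hc y
  rw [hcv', inner_smul_left, conj_trivial] at this
  apply smul_right_injective W hc0
  simp only [smul_smul]
  rw [mul_one, show 3 / 2 * ⟪v, y⟫ = 2 * c ^ 2 * ⟪v, y⟫ by rw [hc2]; ring, ← hc2] at this
  linear_combination (norm := module) this

theorem trace_eq_zero [FiniteDimensional ℝ U] [FiniteDimensional ℝ W] (hU : 2 ≤ finrank ℝ U)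
    (u : U) : LinearMap.trace ℝ W (A u) = 0 := by
  obtain ⟨u', hu', hne⟩ : ∃ u' : U, ⟪u', u⟫ = 0 ∧ u' ≠ 0 := by
    have h1 := Submodule.finrank_add_finrank_orthogonal (ℝ ∙ u)
    have h2 := finrank_span_le_card (R := ℝ) ({u} : Set U)
    rw [Set.toFinset_singleton, Finset.card_singleton] at h2
    have : (ℝ ∙ u)ᗮ ≠ ⊥ := fun h0 => by rw [h0, finrank_bot] at h1; omega
    obtain ⟨x, hx, hx0⟩ := Submodule.exists_mem_ne_zero_of_ne_bot this
    exact ⟨x, Submodule.mem_orthogonal_singleton_iff_inner_left.1 hx, hx0⟩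
  have e1 := h.anticomm u' u
  rw [hu', mul_zero, zero_smul] at e1
  have e2 := h.mul_self u'
  have e3 : LinearMap.trace ℝ W (A u' * A u * A u') =
      (3 / 4 * ⟪u', u'⟫) * LinearMap.trace ℝ W (A u) := by
    rw [LinearMap.trace_mul_comm, ← mul_assoc, e2, smul_one_mul, map_smul, smul_eq_mul]
  have e4 : A u' * A u * A u' = -((3 / 4 * ⟪u', u'⟫) • A u) := by
    rw [eq_neg_of_add_eq_zero_left e1, neg_mul, mul_assoc, e2, mul_smul_one]
  rw [e4, map_neg, map_smul, smul_eq_mul] at e3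
  have : (3 / 4 * ⟪u', u'⟫) * LinearMap.trace ℝ W (A u) = 0 := by linarith
  exact (mul_eq_zero.1 this).resolve_left (mul_ne_zero (by norm_num) (inner_self_ne_zero.2 hne))

theorem two_mul_finrank [Nontrivial W] [FiniteDimensional ℝ U] [FiniteDimensional ℝ W]
    (hU : 2 ≤ finrank ℝ U) : 2 * finrank ℝ U = finrank ℝ W + 2 := by
  obtain ⟨v, hv⟩ := exists_ne (0 : W)
  let a := stdOrthonormalBasis ℝ U
  let b := stdOrthonormalBasis ℝ W
  have hsum : ∑ k, ⟪(2 : ℝ) • A (B v (b k)) v + A (B v v) (b k), b k⟫ =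
      ∑ k, ⟪(3 / 4 * ⟪v, v⟫) • b k + (3 / 2 * ⟪v, b k⟫) • v, b k⟫ := by
    simp only [h.cubic]
  have hB (k) : ⟪A (B v (b k)) v, b k⟫ = ∑ i, ⟪A (a i) v, b k⟫ * ⟪b k, A (a i) v⟫ := by
    rw [← h.inner_left, ← a.sum_inner_mul_inner]
    refine Finset.sum_congr rfl fun i _ => ?_
    rw [h.inner_left, real_inner_comm, real_inner_comm (B v (b k)) (a i), h.inner_left,
      real_inner_comm (b k)]
  have h1 : ∑ k, ⟪A (B v (b k)) v, b k⟫ = finrank ℝ U * (3 / 4 * ⟪v, v⟫) := by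
    simp only [hB]
    rw [Finset.sum_comm]
    simp only [b.sum_inner_mul_inner, h.inner_apply_self]
    simp [a.norm_eq_one]
  have h2 : ∑ k, ⟪A (B v v) (b k), b k⟫ = 0 := by
    rw [← h.trace_eq_zero hU (B v v), LinearMap.trace_eq_sum_inner _ b]
    exact Finset.sum_congr rfl fun k _ => real_inner_comm _ _
  have h3 : ∑ k, ⟪v, b k⟫ * ⟪v, b k⟫ = ⟪v, v⟫ := by
    rw [← b.sum_inner_mul_inner v v]
    exact Finset.sum_congr rfl fun k _ => by rw [real_inner_comm v]
  have h4 (k) : ⟪b k, b k⟫ = 1 := by rw [real_inner_self_eq_norm_sq, b.norm_eq_one, one_pow]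
  simp only [inner_add_left, inner_smul_left, conj_trivial, Finset.sum_add_distrib, h4, mul_assoc,
    ← Finset.mul_sum, h1, h2, h3] at hsum
  simp only [mul_one, Finset.sum_const, Finset.card_univ, Fintype.card_fin, nsmul_eq_mul,
    add_zero] at hsum
  have hv0 : ⟪v, v⟫ ≠ 0 := inner_self_ne_zero.2 hv
  have : (2 * finrank ℝ U : ℝ) = finrank ℝ W + 2 := by
    apply mul_right_cancel₀ hv0
    linarith
  exact_mod_cast this

theorem two_pow_dvd_finrank [FiniteDimensional ℝ U] [FiniteDimensional ℝ W] :
    2 ^ (finrank ℝ U / 2) ∣ finrank ℝ W := by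
  let a := stdOrthonormalBasis ℝ U
  rw [← Module.finrank_baseChange (R := ℂ) (S := ℝ) (M' := W)]
  refine two_pow_dvd_finrank_of_anticommute _ (fun i => (A (a i)).baseChange ℂ) (fun i => ?_)
    fun i j hij => ?_
  · refine ⟨(3 / 4 : ℝ), by norm_num, ?_⟩
    rw [← LinearMap.baseChange_mul, h.mul_self, real_inner_self_eq_norm_sq, a.norm_eq_one,
      LinearMap.baseChange_smul, LinearMap.baseChange_one]
    simp only [one_pow, mul_one]
    exact (algebraMap_smul ℂ _ _).symm
  · have := h.anticomm (a i) (a j)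
    rw [a.inner_eq_zero hij, mul_zero, zero_smul] at this
    rw [← LinearMap.baseChange_mul, ← LinearMap.baseChange_mul,
      eq_neg_of_add_eq_zero_left this, LinearMap.baseChange_neg]

end IsPeirceClifford
end Clifford

section Dimension

open scoped RealInnerProductSpace
open Module (End finrank)
open Module.End (eigenspace mem_eigenspace_iff)

variable {E : Type*} [NormedAddCommGroup E] [InnerProductSpace ℝ E]

namespace IsEiconalProduct

variable {m : E →ₗ[ℝ] E →ₗ[ℝ] E} (hm : IsEiconalProduct m)
include hm

theorem exists_peirceClifford {e : E} (he : ⟪e, e⟫ = 1) (hee : m e e = e) :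
    ∃ (A : eigenspace (m e) (-1) →ₗ[ℝ] End ℝ (eigenspace (m e) (1 / 2)))
      (B : eigenspace (m e) (1 / 2) → eigenspace (m e) (1 / 2) → eigenspace (m e) (-1)),
      (∀ u v, (A u v : E) = m u v) ∧ IsPeirceClifford A B := by
  have hU (u : eigenspace (m e) (-1)) : m e u = (-1 : ℝ) • (u : E) := mem_eigenspace_iff.1 u.2
  have hW (v : eigenspace (m e) (1 / 2)) : m e v = (1 / 2 : ℝ) • (v : E) := mem_eigenspace_iff.1 v.2
  let A : eigenspace (m e) (-1) →ₗ[ℝ] End ℝ (eigenspace (m e) (1 / 2)) :=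
    { toFun u := (m u).restrict fun v hv =>
        mem_eigenspace_iff.2 (hm.mul_neg_half hee (hU u) (mem_eigenspace_iff.1 hv))
      map_add' u u' := by ext; simp
      map_smul' r u := by ext; simp }
  let B (v v' : eigenspace (m e) (1 / 2)) : eigenspace (m e) (-1) :=
    ⟨m v v' - (⟪(v : E), (v' : E)⟫ / 2) • e,
      mem_eigenspace_iff.2 (hm.mul_half_half hee (hW v) (hW v'))⟩
  have hA (u v) : (A u v : E) = m u v := rfl
  have hB (v v') : (B v v' : E) = m v v' - (⟪(v : E), (v' : E)⟫ / 2) • e := rfl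
  refine ⟨A, B, hA, ⟨fun u x y => ?_, fun u u' => ?_, fun v y u => ?_, fun v y => ?_⟩⟩
  · rw [Submodule.coe_inner, Submodule.coe_inner, hA, hA, hm.symm]
  · refine LinearMap.ext fun v => Subtype.ext ?_
    exact hm.mul_mul_neg_half he hee (hU u) (hU u') (hW v)
  · rw [Submodule.coe_inner, Submodule.coe_inner, hA, hB, inner_sub_left, inner_smul_left,
      hm.inner_eq_zero_of_mem_eigenspace hee (by norm_num) (hU u), mul_zero, sub_zero, hm.symm,
      hm.comm, real_inner_comm]
  · apply Subtype.ext
    have h := hm.mul_mul_add (v : E) v y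
    simp only [Submodule.coe_add, Submodule.coe_smul, hA, hB, map_sub, map_smul,
      LinearMap.sub_apply, LinearMap.smul_apply, hW, Submodule.coe_inner]
    rw [hm.comm (m _ _), hm.comm (m _ _)]
    linear_combination (norm := module) h

/-- The cubic form of an eiconal product is of the reducible form `⟪a, x⟫ (3|x|² - 4⟪a, x⟫²)`,
unless the dimension is `5`, `8`, `14` or `26`. -/
theorem reducible_or_finrank [FiniteDimensional ℝ E] (hE : 2 ≤ finrank ℝ E) :
    (∃ a : E, ∀ x, ⟪m x x, x⟫ = ⟪a, x⟫ * (3 * ⟪x, x⟫ - 4 * ⟪a, x⟫ ^ 2)) ∨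
      finrank ℝ E = 5 ∨ finrank ℝ E = 8 ∨ finrank ℝ E = 14 ∨ finrank ℝ E = 26 := by
  have : Nontrivial E := Module.nontrivial_of_finrank_pos (R := ℝ) (by omega)
  obtain ⟨e, he, hee⟩ := hm.exists_idempotent
  have hinner {t : ℝ} {u v : E} (hu : m e u = (-1 : ℝ) • u) (hv : m e v = (1 / 2 : ℝ) • v) :
      ⟪e, t • e + u + v⟫ = t := by
    rw [inner_add_right, inner_add_right, inner_smul_right, he,
      hm.inner_eq_zero_of_mem_eigenspace hee (by norm_num) hu,
      hm.inner_eq_zero_of_mem_eigenspace hee (by norm_num) hv]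
    ring
  obtain ⟨A, B, hA, hAB⟩ := hm.exists_peirceClifford he hee
  have hdim := hm.finrank_eq he hee
  rcases subsingleton_or_nontrivial (eigenspace (m e) (1 / 2)) with hW | hW
  · refine Or.inl ⟨-e, fun x => ?_⟩
    obtain ⟨t, u, hu, v, hv, rfl⟩ := hm.exists_peirce he hee x
    have hv0 : v = 0 := congrArg Subtype.val (Subsingleton.elim (⟨v, hv⟩ : eigenspace (m e) _) 0)
    rw [mem_eigenspace_iff] at hu hv
    rw [hm.cubic_peirce he hee hu hv, hm.inner_peirce he hee hu hv, inner_neg_left, hinner hu hv,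
      hv0, map_zero]
    simp only [inner_zero_left]
    ring
  have hpos := hAB.finrank_pos
  rcases (Nat.succ_le_iff.2 hpos).eq_or_lt with hU | hU
  · obtain ⟨u₀, c, hu₀, hc, hAc, hspan⟩ := hAB.exists_scalar hU.symm
    refine Or.inl ⟨(1 / 2 : ℝ) • e + c • (u₀ : E), fun x => ?_⟩
    obtain ⟨t, u, hu, v, hv, rfl⟩ := hm.exists_peirce he hee x
    obtain ⟨s, rfl⟩ : ∃ s : ℝ, u = s • (u₀ : E) := ⟨_, congrArg Subtype.val (hspan ⟨u, hu⟩)⟩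
    have hmul : m u₀ v = c • v := by
      rw [← hA u₀ ⟨v, hv⟩, hAc, Submodule.coe_smul]
    rw [mem_eigenspace_iff] at hu hv
    have hu₀' := mem_eigenspace_iff.1 u₀.2
    rw [Submodule.coe_inner] at hu₀
    have hu₀x : ⟪(u₀ : E), t • e + s • (u₀ : E) + v⟫ = s := by
      rw [inner_add_right, inner_add_right, inner_smul_right, inner_smul_right, real_inner_comm,
        hm.inner_eq_zero_of_mem_eigenspace hee (by norm_num) hu₀',
        hm.inner_mem_eigenspace hu₀' hv, hu₀]
      ring
    have hax : ⟪(1 / 2 : ℝ) • e + c • (u₀ : E), t • e + s • (u₀ : E) + v⟫ = 1 / 2 * t + c * s := by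
      rw [inner_add_left, inner_smul_left, inner_smul_left, hinner hu hv, hu₀x]
      simp only [conj_trivial]
    rw [hm.cubic_peirce he hee hu hv, hm.inner_peirce he hee hu hv, hax, map_smul,
      LinearMap.smul_apply, hmul]
    simp only [inner_smul_left, inner_smul_right, conj_trivial, hu₀]
    linear_combination (6 * s ^ 2 * t + 4 * c * s ^ 3) * hc
  · have h1 := hAB.two_mul_finrank hU
    have h2 := hAB.two_pow_dvd_finrank
    rw [show finrank ℝ (eigenspace (m e) (1 / 2)) =
      2 * (finrank ℝ (eigenspace (m e) (-1)) - 1) by omega] at h2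
    have := mem_of_two_pow_half_dvd hU h2
    omega

end IsEiconalProduct
end Dimension

section Cubic

open scoped RealInnerProductSpace

variable {σ : Type*}

theorem MvPolynomial.pderiv_comm (i j : σ) (f : MvPolynomial σ ℝ) :
    pderiv i (pderiv j f) = pderiv j (pderiv i f) := by
  have h : ⁅pderiv (R := ℝ) i, pderiv (R := ℝ) j⁆ = 0 := by
    classical
    refine MvPolynomial.derivation_ext fun k => ?_
    rw [Derivation.commutator_apply, pderiv_X, pderiv_X]
    simp [Pi.single_apply, apply_ite]
  have := DFunLike.congr_fun h f
  rw [Derivation.commutator_apply] at this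
  exact sub_eq_zero.1 this

theorem MvPolynomial.isHomogeneous_of_eval_smul {f : MvPolynomial σ ℝ} {k : ℕ}
    (hf : ∀ (t : ℝ) (x : σ → ℝ), eval (t • x) f = t ^ k * eval x f) : f.IsHomogeneous k := by
  have heval {i : ℕ} {p : MvPolynomial σ ℝ} (hp : p.IsHomogeneous i) (x : σ → ℝ) :
      eval ((2 : ℝ) • x) p = 2 ^ i * eval x p := by
    rw [eval_eq, eval_eq, Finset.mul_sum]
    refine Finset.sum_congr rfl fun d hd => ?_
    simp only [Pi.smul_apply, smul_eq_mul, mul_pow, Finset.prod_mul_distrib]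
    rw [Finset.prod_pow_eq_pow_sum, ← hp.degree_eq_sum_deg_support hd]
    ring
  have hzero : ∑ i ∈ Finset.range (f.totalDegree + 1),
      C ((2 : ℝ) ^ i - 2 ^ k) * homogeneousComponent i f = 0 := by
    refine MvPolynomial.funext fun x => ?_
    have h2 := hf 2 x
    rw [← sum_homogeneousComponent f] at h2
    simp only [map_sum, heval (homogeneousComponent_isHomogeneous _ f), Finset.mul_sum] at h2
    simp only [map_sum, map_mul, eval_C, map_zero, sub_mul, Finset.sum_sub_distrib]
    exact sub_eq_zero.2 h2
  intro d hd
  by_contra hne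
  replace hne : d.degree ≠ k := by rw [Finsupp.degree_eq_weight_one]; exact hne
  have hc := congrArg (coeff d) hzero
  have hmem : d.degree ∈ Finset.range (f.totalDegree + 1) :=
    Finset.mem_range_succ_iff.2 (le_totalDegree (mem_support_iff.2 hd))
  simp only [coeff_sum, coeff_C_mul, coeff_homogeneousComponent, coeff_zero] at hc
  rw [Finset.sum_eq_single_of_mem _ hmem fun i _ hi => by rw [if_neg hi.symm, mul_zero],
    if_pos rfl] at hc
  have h2 := (mul_eq_zero.1 hc).resolve_right hd
  exact hne (pow_right_injective₀ two_pos (by norm_num) (sub_eq_zero.1 h2))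

theorem MvPolynomial.IsHomogeneous.sum_mul_eval_pderiv [Fintype σ] {f : MvPolynomial σ ℝ} {k : ℕ}
    (hf : f.IsHomogeneous k) (x : σ → ℝ) : ∑ i, x i * eval x (pderiv i f) = k * eval x f := by
  simpa using congrArg (eval x) hf.sum_X_mul_pderiv

/-- The commutative product on `ℝⁿ` whose structure constants are the third derivatives of a
cubic form, normalised so that `⟪x ∘ x, x⟫ = f x`. -/
noncomputable def cubicProduct [Fintype σ] (f : MvPolynomial σ ℝ) :
    EuclideanSpace ℝ σ →ₗ[ℝ] EuclideanSpace ℝ σ →ₗ[ℝ] EuclideanSpace ℝ σ :=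
  LinearMap.mk₂ ℝ (fun x y => WithLp.toLp 2 fun i =>
      1 / 6 * ∑ j, ∑ k, coeff 0 (pderiv k (pderiv j (pderiv i f))) * (x j * y k))
    (fun x x' y => by
      ext i
      simp only [PiLp.add_apply, add_mul, mul_add, Finset.sum_add_distrib])
    (fun r x y => by
      ext i
      simp only [PiLp.smul_apply, smul_eq_mul, Finset.mul_sum]
      exact Finset.sum_congr rfl fun _ _ => Finset.sum_congr rfl fun _ _ => by ring)
    (fun x y y' => by
      ext i
      simp only [PiLp.add_apply, mul_add, Finset.sum_add_distrib])
    (fun r x y => by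
      ext i
      simp only [PiLp.smul_apply, smul_eq_mul, Finset.mul_sum]
      exact Finset.sum_congr rfl fun _ _ => Finset.sum_congr rfl fun _ _ => by ring)

theorem cubicProduct_apply [Fintype σ] (f : MvPolynomial σ ℝ) (x y : EuclideanSpace ℝ σ) (i : σ) :
    cubicProduct f x y i =
      1 / 6 * ∑ j, ∑ k, coeff 0 (pderiv k (pderiv j (pderiv i f))) * (x j * y k) := rfl

theorem cubicProduct_self [Fintype σ] {f : MvPolynomial σ ℝ} (hf : f.IsHomogeneous 3)
    (x : EuclideanSpace ℝ σ) (i : σ) : cubicProduct f x x i = 1 / 3 * eval x (pderiv i f) := by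
  have h1 := hf.pderiv (i := i)
  have e1 := h1.sum_mul_eval_pderiv x
  have e2 (j : σ) := (h1.pderiv (i := j)).sum_mul_eval_pderiv x
  have e3 (j k : σ) : eval x (pderiv k (pderiv j (pderiv i f))) =
      coeff 0 (pderiv k (pderiv j (pderiv i f))) := by
    have := ((h1.pderiv (i := j)).pderiv (i := k))
    rw [totalDegree_eq_zero_iff_eq_C.1 ((totalDegree_zero_iff_isHomogeneous σ).2 this), eval_C,
      coeff_zero_C]
  simp only [Nat.reduceSub, Nat.cast_one, one_mul, Nat.cast_ofNat] at e1 e2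
  rw [cubicProduct_apply, ← mul_right_inj' (two_ne_zero' ℝ)]
  simp only [← e3]
  have : ∑ j, ∑ k, eval x (pderiv k (pderiv j (pderiv i f))) * (x j * x k) =
      2 * eval x (pderiv i f) := by
    rw [← e1]
    refine Finset.sum_congr rfl fun j _ => ?_
    rw [← e2 j, Finset.mul_sum]
    exact Finset.sum_congr rfl fun k _ => by ring
  rw [this]
  ring

theorem inner_cubicProduct_self [Fintype σ] {f : MvPolynomial σ ℝ} (hf : f.IsHomogeneous 3)
    (x : EuclideanSpace ℝ σ) : ⟪cubicProduct f x x, x⟫ = eval x f := by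
  have := hf.sum_mul_eval_pderiv x
  simp only [PiLp.inner_apply, cubicProduct_self hf, RCLike.inner_apply, conj_trivial]
  rw [← mul_right_inj' (three_ne_zero' ℝ)]
  push_cast at this
  rw [← this, Finset.mul_sum]
  exact Finset.sum_congr rfl fun i _ => by ring

theorem isEiconalProduct_cubicProduct [Fintype σ] {f : MvPolynomial σ ℝ} (hf : f.IsHomogeneous 3)
    (heiconal : ∀ x : σ → ℝ, ∑ i, (eval x (pderiv i f)) ^ 2 = 9 * (∑ i, x i ^ 2) ^ 2) :
    IsEiconalProduct (cubicProduct f) where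
  comm x y := by
    ext i
    rw [cubicProduct_apply, cubicProduct_apply, Finset.sum_comm]
    refine congrArg (1 / 6 * ·) (Finset.sum_congr rfl fun j _ => Finset.sum_congr rfl fun k _ => ?_)
    rw [pderiv_comm j k, mul_comm (x k)]
  symm x y z := by
    have hswap (g : σ → σ → σ → ℝ) : ∑ i, ∑ j, ∑ k, g i j k = ∑ i, ∑ j, ∑ k, g k j i := by
      rw [Finset.sum_comm]
      simp_rw [Finset.sum_comm (f := fun i k => g i _ k)]
      exact Finset.sum_comm
    simp only [PiLp.inner_apply, cubicProduct_apply, RCLike.inner_apply, conj_trivial,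
      Finset.mul_sum, Finset.sum_mul]
    rw [hswap]
    refine Finset.sum_congr rfl fun i _ => Finset.sum_congr rfl fun j _ =>
      Finset.sum_congr rfl fun k _ => ?_
    rw [pderiv_comm i j, pderiv_comm i k, pderiv_comm j k]
    ring
  inner_sq_sq x := by
    simp only [PiLp.inner_apply, cubicProduct_self hf, RCLike.inner_apply, conj_trivial]
    have h := heiconal x
    simp only [← pow_two, mul_pow, ← Finset.mul_sum, h]
    ring

theorem not_irreducible_of_eval_eq [Fintype σ] {f : MvPolynomial σ ℝ} (a : EuclideanSpace ℝ σ)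
    (hf : ∀ x : EuclideanSpace ℝ σ, eval x f = ⟪a, x⟫ * (3 * ⟪x, x⟫ - 4 * ⟪a, x⟫ ^ 2)) :
    ¬ Irreducible f := by
  intro hirr
  let l : MvPolynomial σ ℝ := ∑ i, C (a i) * X i
  let q : MvPolynomial σ ℝ := C 3 * ∑ i, X i ^ 2 - C 4 * l ^ 2
  have hl (x : σ → ℝ) : eval x l = ⟪a, WithLp.toLp 2 x⟫ := by
    simp [l, PiLp.inner_apply, mul_comm]
  have hq (x : σ → ℝ) : eval x q = 3 * ∑ i, x i ^ 2 - 4 * eval x l ^ 2 := by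
    simp [q]
  have hfac : f = l * q := by
    refine MvPolynomial.funext fun x => ?_
    have := hf (WithLp.toLp 2 x)
    rw [map_mul, hq, hl]
    rw [WithLp.ofLp_toLp] at this
    simp only [this, PiLp.inner_apply, RCLike.inner_apply, conj_trivial, pow_two]
  have hl0 : eval 0 l = 0 := by simp [l]
  have hq0 : eval 0 q = 0 := by rw [hq, hl0]; simp
  rcases hirr.isUnit_or_isUnit hfac with h | h
  · exact (h.map (eval (0 : σ → ℝ))).ne_zero hl0
  · exact (h.map (eval (0 : σ → ℝ))).ne_zero hq0

end Cubic

/-- If a homogeneous cubic polynomial on `ℝⁿ` (`n ≥ 2`) satisfies the eiconal equation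
`|∇f(x)|² = 9|x|⁴` and is irreducible over `ℝ`, then `n ∈ {5, 8, 14, 26}`. -/
theorem irreducible_eiconal_cubic_dimensions (n : ℕ) (hn : 2 ≤ n)
    (f : MvPolynomial (Fin n) ℝ)
    (hcubic : ∀ (t : ℝ) (x : Fin n → ℝ), eval (t • x) f = t ^ 3 * eval x f)
    (heiconal : ∀ x : Fin n → ℝ,
      ∑ i, (eval x (pderiv i f)) ^ 2 = 9 * (∑ i, x i ^ 2) ^ 2)
    (hirr : Irreducible f) :
    n ∈ ({5, 8, 14, 26} : Set ℕ) := by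
  have hf := MvPolynomial.isHomogeneous_of_eval_smul hcubic
  have hm := isEiconalProduct_cubicProduct hf heiconal
  have hfin : Module.finrank ℝ (EuclideanSpace ℝ (Fin n)) = n := finrank_euclideanSpace_fin
  rcases hm.reducible_or_finrank (by rwa [hfin]) with ⟨a, ha⟩ | h
  · refine absurd hirr (not_irreducible_of_eval_eq a fun x => ?_)
    rw [← ha, inner_cubicProduct_self hf]
  · rwa [hfin] at h
end

section
/- Let m = 2k be an even positive integer. Then the maximal integer r for which there exist symmetric real m×m matrices A₁, …, A_r with A_i² = 1ₘ for all i and A_iA_j + A_jA_i = 0 for all i ≠ j equals 1 plus the maximal integer r′ for which there exist real k×k matrices E₁, …, E_{r′} with E_iᵗE_i = 1ₖ for all i and E_iᵗE_j + E_jᵗE_i = 0 for all i ≠ j. -/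
open Matrix

/-- A real symmetric idempotent matrix of trace `k` is `V * Vᵀ` for a matrix `V` with `k`
orthonormal columns. -/
theorem exists_orthonormal_columns {n : Type*} [Fintype n] [DecidableEq n] {k : ℕ}
    {Q : Matrix n n ℝ} (hQ : Q.IsSymm) (hQQ : Q * Q = Q) (htr : Q.trace = k) :
    ∃ V : Matrix n (Fin k) ℝ, Vᵀ * V = 1 ∧ V * Vᵀ = Q := by
  have hH : Q.IsHermitian := by
    rw [Matrix.IsHermitian, conjTranspose_eq_transpose_of_trivial]
    exact hQ
  let U : Matrix n n ℝ := hH.eigenvectorUnitary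
  have hUU : Uᵀ * U = 1 := by
    have h := (Matrix.mem_unitaryGroup_iff' (A := U)).1 hH.eigenvectorUnitary.2
    rwa [star_eq_conjTranspose, conjTranspose_eq_transpose_of_trivial] at h
  have hspec : Q = U * diagonal hH.eigenvalues * Uᵀ := by
    have h := hH.spectral_theorem
    rw [Unitary.conjStarAlgAut_apply] at h
    simpa [U, star_eq_conjTranspose, conjTranspose_eq_transpose_of_trivial, Function.comp_def]
      using h
  have hdiag : diagonal hH.eigenvalues = Uᵀ * Q * U := by
    calc diagonal hH.eigenvalues = (Uᵀ * U) * diagonal hH.eigenvalues * (Uᵀ * U) := by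
          rw [hUU, one_mul, mul_one]
      _ = Uᵀ * (U * diagonal hH.eigenvalues * Uᵀ) * U := by simp only [mul_assoc]
      _ = Uᵀ * Q * U := by rw [← hspec]
  have hUU' : U * Uᵀ = 1 := mul_eq_one_comm.1 hUU
  have hsq : diagonal hH.eigenvalues * diagonal hH.eigenvalues = diagonal hH.eigenvalues := by
    calc _ = Uᵀ * Q * U * (Uᵀ * Q * U) := by rw [hdiag]
      _ = Uᵀ * Q * (U * Uᵀ) * Q * U := by simp only [mul_assoc]
      _ = Uᵀ * (Q * Q) * U := by rw [hUU']; simp only [mul_assoc, one_mul]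
      _ = _ := by rw [hQQ, hdiag]
  have h01 : ∀ i, hH.eigenvalues i = if hH.eigenvalues i = 1 then 1 else 0 := by
    intro i
    have h := congrFun (congrFun hsq i) i
    rw [diagonal_mul_diagonal, diagonal_apply_eq, diagonal_apply_eq] at h
    split_ifs with h1
    · exact h1
    · have : hH.eigenvalues i * (hH.eigenvalues i - 1) = 0 := by linarith
      exact (mul_eq_zero.1 this).resolve_right (sub_ne_zero.2 h1)
  have hcard : Fintype.card {i // hH.eigenvalues i = 1} = k := by
    have h := hH.trace_eq_sum_eigenvalues
    have h' : (k : ℝ) = ∑ i, if hH.eigenvalues i = 1 then (1 : ℝ) else 0 :=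
      htr.symm.trans (h.trans (Finset.sum_congr rfl fun i _ => h01 i))
    rw [Finset.sum_boole] at h'
    rw [Fintype.card_subtype]
    exact_mod_cast h'.symm
  let e : Fin k ≃ {i // hH.eigenvalues i = 1} := (Fintype.equivFinOfCardEq hcard).symm
  refine ⟨U.submatrix id fun j => (e j : n), ?_, ?_⟩
  · rw [transpose_submatrix, ← submatrix_mul _ _ _ _ _ Function.bijective_id, hUU]
    exact submatrix_one _ (Subtype.val_injective.comp e.injective)
  · ext i j
    have hij : Q i j = ∑ l, U i l * hH.eigenvalues l * U j l := by
      refine (congrFun (congrFun hspec i) j).trans ?_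
      simp only [mul_apply (N := Uᵀ), mul_diagonal, transpose_apply]
    rw [hij, mul_apply]
    simp only [submatrix_apply, transpose_apply, id]
    rw [e.sum_comp fun l => U i l * U j l,
      ← Finset.sum_subtype (Finset.univ.filter fun l => hH.eigenvalues l = 1) (by simp)
        fun l => U i l * U j l, Finset.sum_filter]
    refine Finset.sum_congr rfl fun l _ => ?_
    split_ifs with h
    · rw [h, mul_one]
    · rw [(h01 l).trans (if_neg h), mul_zero, zero_mul]

/-- The Hurwitz equations for a pair of matrices imply those for the transposes. -/
theorem mul_transpose_add_mul_transpose_eq_zero {n : Type*} [Fintype n] [DecidableEq n]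
    {E F : Matrix n n ℝ} (hE : Eᵀ * E = 1) (h : Eᵀ * F + Fᵀ * E = 0) :
    E * Fᵀ + F * Eᵀ = 0 := by
  have hE' : E * Eᵀ = 1 := mul_eq_one_comm.1 hE
  calc E * Fᵀ + F * Eᵀ = E * Fᵀ * (E * Eᵀ) + E * Eᵀ * F * Eᵀ := by
        rw [hE', mul_one, one_mul]
    _ = E * (Eᵀ * F + Fᵀ * E) * Eᵀ := by noncomm_ring
    _ = 0 := by rw [h, mul_zero, zero_mul]

theorem exists_symm_system_of_hurwitz {k s : ℕ} (E : Fin s → Matrix (Fin k) (Fin k) ℝ)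
    (hE : ∀ i, (E i)ᵀ * E i = 1) (hE' : ∀ i j, i ≠ j → (E i)ᵀ * E j + (E j)ᵀ * E i = 0) :
    ∃ A : Fin (s + 1) → Matrix (Fin (2 * k)) (Fin (2 * k)) ℝ,
      (∀ i, (A i).IsSymm) ∧ (∀ i, A i * A i = 1) ∧
      (∀ i j, i ≠ j → A i * A j + A j * A i = 0) := by
  let B : Fin (s + 1) → Matrix (Fin k ⊕ Fin k) (Fin k ⊕ Fin k) ℝ :=
    Fin.cons (fromBlocks 1 0 0 (-1)) fun i => fromBlocks 0 (E i)ᵀ (E i) 0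
  let e : Fin k ⊕ Fin k ≃ Fin (2 * k) := finSumFinEquiv.trans (finCongr (two_mul k).symm)
  let φ := reindexAlgEquiv ℝ ℝ e
  have hB : ∀ i, (B i).IsSymm := by
    intro i
    cases i using Fin.cases <;> simp [B, IsSymm, fromBlocks_transpose]
  refine ⟨fun i => φ (B i), fun i => ?_, fun i => ?_, fun i j hij => ?_⟩
  · simpa [φ] using (hB i).submatrix e.symm
  · rw [← map_mul, ← map_one φ]
    congr 1
    cases i using Fin.cases with
    | zero => simp [B, fromBlocks_multiply]
    | succ i => simp [B, fromBlocks_multiply, hE, mul_eq_one_comm.1 (hE i)]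
  · rw [← map_mul, ← map_mul, ← map_add, ← map_zero φ]
    congr 1
    cases i using Fin.cases with
    | zero =>
      cases j using Fin.cases with
      | zero => exact absurd rfl hij
      | succ j => simp [B, fromBlocks_multiply, fromBlocks_add]
    | succ i =>
      cases j using Fin.cases with
      | zero => simp [B, fromBlocks_multiply, fromBlocks_add]
      | succ j =>
        have h := hE' i j fun h => hij (congrArg Fin.succ h)
        simp [B, fromBlocks_multiply, fromBlocks_add, h,
          mul_transpose_add_mul_transpose_eq_zero (hE i) h]

theorem trace_eq_zero_of_anticommute {n : Type*} [Fintype n] [DecidableEq n]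
    {A B : Matrix n n ℝ} (hB : B * B = 1) (h : A * B + B * A = 0) : A.trace = 0 := by
  have h1 : (B * A * B).trace = A.trace := by
    rw [trace_mul_comm, ← mul_assoc, hB, one_mul]
  have h2 : B * A * B = -A := by
    rw [← neg_eq_of_add_eq_zero_right h, neg_mul, mul_assoc, hB, mul_one]
  rw [h2, trace_neg] at h1
  linarith

theorem exists_hurwitz_of_symm_system {k s : ℕ}
    (A : Fin (s + 1) → Matrix (Fin (2 * k)) (Fin (2 * k)) ℝ)
    (hA : ∀ i, (A i).IsSymm) (hAA : ∀ i, A i * A i = 1)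
    (hanti : ∀ i j, i ≠ j → A i * A j + A j * A i = 0) :
    ∃ E : Fin s → Matrix (Fin k) (Fin k) ℝ,
      (∀ i, (E i)ᵀ * E i = 1) ∧ (∀ i j, i ≠ j → (E i)ᵀ * E j + (E j)ᵀ * E i = 0) := by
  rcases s with _ | s
  · exact ⟨fun i => i.elim0, fun i => i.elim0, fun i => i.elim0⟩
  set Q : Matrix (Fin (2 * k)) (Fin (2 * k)) ℝ := (1 / 2 : ℝ) • (1 + A 0) with hQdef
  have hQ : Q.IsSymm := (isSymm_one.add (hA 0)).smul _
  have hQQ : Q * Q = Q := by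
    rw [hQdef, smul_mul_smul_comm, add_mul, mul_add, mul_add, hAA, one_mul, one_mul, mul_one]
    module
  have htr : Q.trace = k := by
    rw [hQdef, trace_smul, trace_add,
      trace_eq_zero_of_anticommute (hAA 1) (hanti 0 1 (by simp)), trace_one]
    simp
  obtain ⟨V, hV, hVV⟩ := exists_orthonormal_columns hQ hQQ htr
  have hQV : Q * V = V := by rw [← hVV, Matrix.mul_assoc, hV, Matrix.mul_one]
  have hswap : ∀ i : Fin (s + 1), Q * A i.succ = A i.succ * (1 - Q) := by
    intro i
    have h := hanti 0 i.succ (Fin.succ_ne_zero i).symm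
    rw [hQdef, smul_mul_assoc, mul_sub, mul_smul_comm, add_mul, mul_add, eq_neg_of_add_eq_zero_left h,
      mul_one, one_mul]
    module
  have key : ∀ i j : Fin (s + 1), (Vᵀ * A 1 * A i.succ * V)ᵀ * (Vᵀ * A 1 * A j.succ * V) =
      Vᵀ * (A i.succ * A j.succ) * V := by
    intro i j
    simp only [transpose_mul, transpose_transpose, (hA _).eq]
    calc Vᵀ * (A i.succ * (A 1 * V)) * (Vᵀ * A 1 * A j.succ * V)
        = Vᵀ * A i.succ * A 1 * ((V * Vᵀ) * A (Fin.succ 0)) * A j.succ * V := by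
          simp only [Matrix.mul_assoc, Fin.succ_zero_eq_one]
      _ = Vᵀ * A i.succ * (A 1 * A 1) * (A j.succ - Q * A j.succ) * V := by
          rw [hVV, hswap, Fin.succ_zero_eq_one]
          simp only [Matrix.mul_assoc, Matrix.sub_mul, Matrix.one_mul]
      _ = Vᵀ * A i.succ * (A j.succ * (Q * V)) := by
          rw [hAA, hswap, Matrix.mul_one, mul_sub (A j.succ), Matrix.mul_one, sub_sub_cancel]
          simp only [Matrix.mul_assoc]
      _ = Vᵀ * (A i.succ * A j.succ) * V := by
          rw [hQV]
          simp only [Matrix.mul_assoc]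
  refine ⟨fun i => Vᵀ * A 1 * A i.succ * V, fun i => ?_, fun i j hij => ?_⟩
  · rw [key, hAA, Matrix.mul_one, hV]
  · rw [key, key, ← Matrix.add_mul, ← Matrix.mul_add, hanti _ _ fun h => hij (Fin.succ_injective _ h),
      Matrix.mul_zero, Matrix.zero_mul]

theorem hurwitz_card_le {k s : ℕ} (hk : 1 ≤ k) (E : Fin s → Matrix (Fin k) (Fin k) ℝ)
    (hE : ∀ i, (E i)ᵀ * E i = 1) (hE' : ∀ i j, i ≠ j → (E i)ᵀ * E j + (E j)ᵀ * E i = 0) :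
    s ≤ k * k := by
  have htr : ∀ i j, ((E i)ᵀ * E j).trace = if i = j then (k : ℝ) else 0 := by
    intro i j
    split_ifs with h
    · rw [h, hE, trace_one, Fintype.card_fin]
    · have h1 := congrArg trace (hE' i j h)
      have h2 : ((E j)ᵀ * E i).trace = ((E i)ᵀ * E j).trace := by
        rw [← trace_transpose, transpose_mul, transpose_transpose]
      rw [trace_add, h2, trace_zero] at h1
      linarith
  have hli : LinearIndependent ℝ E := by
    rw [Fintype.linearIndependent_iff]
    intro g hg i
    have h := congrArg (fun M => ((E i)ᵀ * M).trace) hg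
    simp only [Matrix.mul_sum, trace_sum, Matrix.mul_smul, trace_smul, htr, mul_zero,
      trace_zero, smul_eq_mul, mul_ite, Finset.sum_ite_eq, Finset.mem_univ, if_true] at h
    exact (mul_eq_zero.1 h).resolve_right (by positivity)
  simpa [Module.finrank_matrix] using hli.fintype_card_le_finrank

/-- For even `m = 2k > 0`: the maximal number `r` of symmetric real `m × m` matrices
satisfying `A_i² = 1ₘ` and `A_iA_j + A_jA_i = 0` (`i ≠ j`) equals `1` plus the
maximal number `r′` of real `k × k` matrices satisfying the Hurwitz matrix
equations `E_iᵗE_i = 1ₖ`, `E_iᵗE_j + E_jᵗE_i = 0` (`i ≠ j`). -/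
theorem rho_symm_eq_one_add_rho (k : ℕ) (hk : 1 ≤ k) :
    ∃ r r' : ℕ,
      IsGreatest {s : ℕ | ∃ A : Fin s → Matrix (Fin (2 * k)) (Fin (2 * k)) ℝ,
        (∀ i, (A i).IsSymm) ∧ (∀ i, A i * A i = 1) ∧
        (∀ i j, i ≠ j → A i * A j + A j * A i = 0)} r ∧
      IsGreatest {s : ℕ | ∃ E : Fin s → Matrix (Fin k) (Fin k) ℝ,
        (∀ i, (E i)ᵀ * E i = 1) ∧
        (∀ i j, i ≠ j → (E i)ᵀ * E j + (E j)ᵀ * E i = 0)} r' ∧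
      r = 1 + r' := by
  set H : Set ℕ := {s : ℕ | ∃ E : Fin s → Matrix (Fin k) (Fin k) ℝ,
    (∀ i, (E i)ᵀ * E i = 1) ∧ (∀ i j, i ≠ j → (E i)ᵀ * E j + (E j)ᵀ * E i = 0)}
  have hne : H.Nonempty := ⟨0, fun i => i.elim0, fun i => i.elim0, fun i => i.elim0⟩
  have hbdd : BddAbove H := ⟨k * k, fun s ⟨E, hE, hE'⟩ => hurwitz_card_le hk E hE hE'⟩
  have hmax : IsGreatest H (sSup H) := ⟨Nat.sSup_mem hne hbdd, fun s hs => le_csSup hbdd hs⟩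
  refine ⟨1 + sSup H, sSup H, ⟨?_, ?_⟩, hmax, rfl⟩
  · obtain ⟨E, hE, hE'⟩ := hmax.1
    rw [add_comm]
    exact exists_symm_system_of_hurwitz E hE hE'
  · rintro (_ | s) ⟨A, hA, hAA, hanti⟩
    · exact Nat.zero_le _
    · rw [add_comm]
      exact Nat.add_le_add_left (hmax.2 (exists_hurwitz_of_symm_system A hA hAA hanti)) 1
end
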